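/- Let A be a finite algebra and let ρ, σ ∈ Con(A) be irreducible congruences that are adjacent, i.e., there exists a reflexive bridge from (A,ρ) to (A,σ). Then Opt(ρ) = Opt(σ), where Opt(ρ) denotes Opt(ρ,ρ*). -/

import Mathlib

namespace Zhuk

/-- A signature: a type of operation symbols with arities. -/
structure Signature where
  ops : Type
  arity : ops → ℕ

/-- An algebra structure of signature `S` on carrier `A`. -/
class SAlg (S : Signature) (A : Type) where
  interp : (o : S.ops) → (Fin (S.arity o) → A) → A

variable {S : Signature}

/-- Componentwise algebra structure on a product. -/
instance prodSAlg {A B : Type} [SAlg S A] [SAlg S B] : SAlg S (A × B) :=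
  ⟨fun o x => (SAlg.interp o fun i => (x i).1, SAlg.interp o fun i => (x i).2)⟩

/-- A subset closed under all the operations. -/
def IsSubuniverse (S : Signature) {A : Type} [SAlg S A] (R : Set A) : Prop :=
  ∀ (o : S.ops) (x : Fin (S.arity o) → A), (∀ i, x i ∈ R) → SAlg.interp o x ∈ R

/-- The algebra structure on (the subtype of) a subuniverse. -/
def subAlg {A : Type} [SAlg S A] (R : Set A) (h : IsSubuniverse S R) : SAlg S ↥R :=
  ⟨fun o x => ⟨SAlg.interp o fun i => (x i).1, h o _ fun i => (x i).2⟩⟩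

/-- Terms of signature `S` in `n` variables. -/
inductive STerm (S : Signature) (n : ℕ) : Type
  | var : Fin n → STerm S n
  | app (o : S.ops) : (Fin (S.arity o) → STerm S n) → STerm S n

/-- Evaluation of a term in an algebra. -/
def STerm.eval {A : Type} [SAlg S A] {n : ℕ} : STerm S n → (Fin n → A) → A
  | .var i, v => v i
  | .app o ts, v => SAlg.interp o fun i => (ts i).eval v

/-- The diagonal (smallest) congruence `0_A`. -/
def diag (A : Type) : Set (A × A) := {p | p.1 = p.2}

/-- Relational composition. -/
def rcomp {A B C : Type} (R : Set (A × B)) (T : Set (B × C)) : Set (A × C) :=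
  {p | ∃ b, (p.1, b) ∈ R ∧ (b, p.2) ∈ T}

/-- Relational inverse. -/
def rinv {A B : Type} (R : Set (A × B)) : Set (B × A) := {p | (p.2, p.1) ∈ R}

/-- Transitive closure of a binary relation (as a set of pairs). -/
def transCl {A : Type} (R : Set (A × A)) : Set (A × A) :=
  {p | Relation.TransGen (fun a b => (a, b) ∈ R) p.1 p.2}

/-- `R` is stable under (saturated with respect to) `ρ`:  `R = ρ ∘ R ∘ ρ`. -/
def Saturated {A : Type} (ρ R : Set (A × A)) : Prop := rcomp ρ (rcomp R ρ) = R

/-- A congruence: a subuniverse of `A²` which is an equivalence relation. -/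
def IsCongruence (S : Signature) {A : Type} [SAlg S A] (θ : Set (A × A)) : Prop :=
  IsSubuniverse S θ ∧ Equivalence fun a b => (a, b) ∈ θ

/-- `ρ ∈ Con*(A)`: a congruence different from the full congruence `1_A`. -/
def ConStar (S : Signature) {A : Type} [SAlg S A] (ρ : Set (A × A)) : Prop :=
  IsCongruence S ρ ∧ ρ ≠ Set.univ

/-- The ternary centralizer relation `C(φ, θ; δ)`, via the term condition. -/
def Centralizes (S : Signature) {A : Type} [SAlg S A] (φ θ δ : Set (A × A)) : Prop :=
  ∀ (n : ℕ) (t : STerm S (n + 1)) (a b : A) (c d : Fin n → A),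
    (a, b) ∈ φ → (∀ i, (c i, d i) ∈ θ) →
    (t.eval (Fin.cons a c), t.eval (Fin.cons a d)) ∈ δ →
    (t.eval (Fin.cons b c), t.eval (Fin.cons b d)) ∈ δ

/-- The centralizer `(δ : θ)`: the largest congruence `φ` with `C(φ, θ; δ)`. -/
def centralizer (S : Signature) {A : Type} [SAlg S A] (δ θ : Set (A × A)) : Set (A × A) :=
  ⋃₀ {φ | IsCongruence S φ ∧ Centralizes S φ θ δ}

/-- A congruence of the subalgebra `A(θ) ≤ A²`, viewed ambiently as a subset of
`(A×A) × (A×A)` whose field is `θ`. -/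
def IsConOn (S : Signature) {A : Type} [SAlg S A] (θ : Set (A × A))
    (Δ : Set ((A × A) × (A × A))) : Prop :=
  Δ ⊆ θ ×ˢ θ ∧ IsSubuniverse S Δ ∧ (∀ p ∈ θ, (p, p) ∈ Δ) ∧
    (∀ p q, (p, q) ∈ Δ → (q, p) ∈ Δ) ∧ (∀ p q r, (p, q) ∈ Δ → (q, r) ∈ Δ → (p, r) ∈ Δ)

/-- `Δ_{θ,α}`: the congruence of `A(θ)` generated by `{((a,a),(b,b)) : (a,b) ∈ α}`. -/
def DeltaCon (S : Signature) {A : Type} [SAlg S A] (θ α : Set (A × A)) :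
    Set ((A × A) × (A × A)) :=
  ⋂₀ {Δ | IsConOn S θ Δ ∧ ∀ a b : A, (a, b) ∈ α → ((a, a), (b, b)) ∈ Δ}

/-- Projection of a quaternary relation to its first two coordinates. -/
def pr12 {A B : Type} (T : Set (A × A × B × B)) : Set (A × A) :=
  {p | ∃ b₁ b₂, (p.1, p.2, b₁, b₂) ∈ T}

/-- Projection of a quaternary relation to its last two coordinates. -/
def pr34 {A B : Type} (T : Set (A × A × B × B)) : Set (B × B) :=
  {q | ∃ a₁ a₂, (a₁, a₂, q.1, q.2) ∈ T}

/-- The trace of a quaternary relation. -/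
def btr {A B : Type} (T : Set (A × A × B × B)) : Set (A × B) :=
  {p | (p.1, p.1, p.2, p.2) ∈ T}

/-- Zhuk's bridges: Definition 4.3 (B0*), (B1*), (B2*). -/
def IsBridge (S : Signature) {A B : Type} [SAlg S A] [SAlg S B]
    (ρ : Set (A × A)) (σ : Set (B × B)) (T : Set (A × A × B × B)) : Prop :=
  IsSubuniverse S T ∧
  (∀ a₁ a₂ b₁ b₂ a₁' a₂', (a₁, a₂, b₁, b₂) ∈ T → (a₁, a₁') ∈ ρ → (a₂, a₂') ∈ ρ →
    (a₁', a₂', b₁, b₂) ∈ T) ∧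
  (∀ a₁ a₂ b₁ b₂ b₁' b₂', (a₁, a₂, b₁, b₂) ∈ T → (b₁, b₁') ∈ σ → (b₂, b₂') ∈ σ →
    (a₁, a₂, b₁', b₂') ∈ T) ∧
  ρ ⊂ pr12 T ∧ σ ⊂ pr34 T ∧
  (∀ a₁ a₂ b₁ b₂, (a₁, a₂, b₁, b₂) ∈ T → ((a₁, a₂) ∈ ρ ↔ (b₁, b₂) ∈ σ))

/-- A bridge from `(A,ρ,L)` to `(B,σ,R)`: a bridge with prescribed anchors. -/
def IsBridgeLR (S : Signature) {A B : Type} [SAlg S A] [SAlg S B]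
    (ρ : Set (A × A)) (σ : Set (B × B)) (L : Set (A × A)) (R : Set (B × B))
    (T : Set (A × A × B × B)) : Prop :=
  IsBridge S ρ σ T ∧ pr12 T = L ∧ pr34 T = R

/-- A reflexive bridge (case `B = A`): `0_A ⊆ tr(T)`. -/
def ReflBridge {A : Type} (T : Set (A × A × A × A)) : Prop :=
  ∀ a : A, (a, a) ∈ btr T

/-- `Cov(ρ)`: the inclusion-minimal ρ-saturated subuniverses of `A²` properly containing ρ. -/
def Cov (S : Signature) {A : Type} [SAlg S A] (ρ : Set (A × A)) : Set (Set (A × A)) :=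
  {L | IsSubuniverse S L ∧ Saturated ρ L ∧ ρ ⊂ L ∧
    ∀ L', IsSubuniverse S L' → Saturated ρ L' → ρ ⊂ L' → L' ⊆ L → L' = L}

/-- `ref.tr(ρ,L)`: traces of reflexive bridges from `(A,ρ,L)` to itself. -/
def refTr (S : Signature) {A : Type} [SAlg S A] (ρ L : Set (A × A)) : Set (Set (A × A)) :=
  {γ | ∃ T : Set (A × A × A × A), IsBridgeLR S ρ ρ L L T ∧ ReflBridge T ∧ btr T = γ}

/-- `γ = Opt(ρ,L)`: `γ` is the (unique) inclusion-maximal member of `ref.tr(ρ,L)`. -/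
def IsOptOf (S : Signature) {A : Type} [SAlg S A] (ρ L γ : Set (A × A)) : Prop :=
  γ ∈ refTr S ρ L ∧ ∀ δ ∈ refTr S ρ L, γ ⊆ δ → δ = γ

/-- `ρ` is meet-irreducible with unique upper cover `ρplus`. -/
def MeetIrredWith (S : Signature) {A : Type} [SAlg S A] (ρ ρplus : Set (A × A)) : Prop :=
  IsCongruence S ρ ∧ ρ ≠ Set.univ ∧ IsCongruence S ρplus ∧ ρ ⊂ ρplus ∧
    ∀ θ, IsCongruence S θ → ρ ⊂ θ → ρplus ⊆ θ

/-- `Cov⁺(ρ) = {τ ∈ Cov(ρ) : τ ⊆ ρ⁺}`. -/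
def CovPlus (S : Signature) {A : Type} [SAlg S A] (ρ ρplus : Set (A × A)) :
    Set (Set (A × A)) :=
  {τ | τ ∈ Cov S ρ ∧ τ ⊆ ρplus}

/-- A good bridge between meet-irreducible congruences with upper covers `ρplus`, `σplus`. -/
def GoodBridge (S : Signature) {A B : Type} [SAlg S A] [SAlg S B]
    (ρ ρplus : Set (A × A)) (σ σplus : Set (B × B)) (T : Set (A × A × B × B)) : Prop :=
  IsBridge S ρ σ T ∧
    ∃ τ ∈ CovPlus S ρ ρplus, ∃ τ' ∈ CovPlus S σ σplus, ∃ T' ⊆ T,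
      IsBridgeLR S ρ σ τ τ' T' ∧ btr T' = btr T

/-- `t` (with Taylor-identity data `u v`) is idempotent on `A` and satisfies the
corresponding identities on `A`. -/
def TaylorOn (S : Signature) (A : Type) [SAlg S A] {n : ℕ} (t : STerm S n)
    (u v : Fin n → Fin n → Fin 2) : Prop :=
  (∀ a : A, t.eval (fun _ => a) = a) ∧
    ∀ (i : Fin n) (x y : A),
      t.eval (fun j => if u i j = 0 then x else y) =
        t.eval (fun j => if v i j = 0 then x else y)

/-- `A` is a Taylor algebra. -/
def IsTaylorAlg (S : Signature) (A : Type) [SAlg S A] : Prop :=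
  ∃ (n : ℕ) (t : STerm S n) (u v : Fin n → Fin n → Fin 2),
    1 < n ∧ (∀ i, u i i ≠ v i i) ∧ TaylorOn S A t u v

/-- `A` and `B` lie in a common (locally finite, as they are finite) Taylor variety:
they share a common Taylor term with common Taylor identities. -/
def CommonTaylor (S : Signature) (A B : Type) [SAlg S A] [SAlg S B] : Prop :=
  ∃ (n : ℕ) (t : STerm S n) (u v : Fin n → Fin n → Fin 2),
    1 < n ∧ (∀ i, u i i ≠ v i i) ∧ TaylorOn S A t u v ∧ TaylorOn S B t u v

/-- The quotient of `A` by (the equivalence relation of) `θ`. -/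
abbrev ConQuot {A : Type} (θ : Set (A × A)) : Type :=
  Quot (fun a b => (a, b) ∈ θ)

/-- The class of `a` in `A/θ`. -/
def ConQuot.mk {A : Type} (θ : Set (A × A)) (a : A) : ConQuot θ :=
  Quot.mk _ a

/-- The quotient algebra structure on `A/θ` (extensionally correct when `θ` is a
congruence). -/
noncomputable def quotAlg {S : Signature} {A : Type} (iA : SAlg S A) (θ : Set (A × A)) :
    SAlg S (ConQuot θ) :=
  ⟨fun o x => ConQuot.mk θ
    (@SAlg.interp S A iA o fun i => Classical.choose (Quot.exists_rep (x i)))⟩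

/-- `f` is a homomorphism with respect to the given algebra structures. -/
def IsHomI {S : Signature} {A B : Type} (iA : SAlg S A) (iB : SAlg S B) (f : A → B) : Prop :=
  ∀ (o : S.ops) (x : Fin (S.arity o) → A),
    f (@SAlg.interp S A iA o x) = @SAlg.interp S B iB o fun i => f (x i)

/-- The two algebras are isomorphic. -/
def IsoAlgI {S : Signature} {A B : Type} (iA : SAlg S A) (iB : SAlg S B) : Prop :=
  ∃ f : A ≃ B, IsHomI iA iB f

/-- The identity bridge `I_{(A,ρ,L)}`. -/
def idBridge {A : Type} (ρ L : Set (A × A)) : Set (A × A × A × A) :=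
  {p | (p.1, p.2.1) ∈ L ∧ (p.2.2.1, p.2.2.2) ∈ L ∧ (p.1, p.2.2.1) ∈ ρ ∧ (p.2.1, p.2.2.2) ∈ ρ}

/-- Composition of quaternary relations (bridges). -/
def bComp {A B C : Type} (T : Set (A × A × B × B)) (T' : Set (B × B × C × C)) :
    Set (A × A × C × C) :=
  {p | ∃ b₁ b₂, (p.1, p.2.1, b₁, b₂) ∈ T ∧ (b₁, b₂, p.2.2.1, p.2.2.2) ∈ T'}

/-- Converse of a quaternary relation (bridge). -/
def bConv {A B : Type} (T : Set (A × A × B × B)) : Set (B × B × A × A) :=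
  {p | (p.2.2.1, p.2.2.2, p.1, p.2.1) ∈ T}

/-- `Δ♭_{θ,α}`: the congruence `Δ_{θ,α}` of `A(θ)` viewed as a quaternary relation. -/
def deltaFlat (S : Signature) {A : Type} [SAlg S A] (θ α : Set (A × A)) :
    Set (A × A × A × A) :=
  {p | ((p.1, p.2.1), (p.2.2.1, p.2.2.2)) ∈ DeltaCon S θ α}

/-- `T^opt_{(A,ρ)} = I_{(A,ρ,ρ⁺)} ∘ Δ♭_{ρ⁺,(ρ:ρ⁺)} ∘ I_{(A,ρ,ρ⁺)}`. -/
def Topt (S : Signature) {A : Type} [SAlg S A] (ρ ρplus : Set (A × A)) :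
    Set (A × A × A × A) :=
  bComp (idBridge ρ ρplus)
    (bComp (deltaFlat S ρplus (centralizer S ρ ρplus)) (idBridge ρ ρplus))

/-- `A` is subdirectly irreducible with monolith `μ`. -/
def IsMonolith (S : Signature) {A : Type} [SAlg S A] (μ : Set (A × A)) : Prop :=
  IsCongruence S μ ∧ μ ≠ diag A ∧ ∀ θ, IsCongruence S θ → θ ≠ diag A → μ ⊆ θ

/-- The carrier of `D(A,θ)`-style quotients: `A(μ)/Δ_{μ,α}`. -/
abbrev DCar (S : Signature) (A : Type) [SAlg S A] (μ α : Set (A × A)) : Type :=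
  Quot (fun p q : ↥μ => ((p : A × A), (q : A × A)) ∈ DeltaCon S μ α)

/-- The class of a pair `p ∈ μ` in `A(μ)/Δ_{μ,α}`. -/
def DCar.mk (S : Signature) (A : Type) [SAlg S A] (μ α : Set (A × A)) (p : ↥μ) :
    DCar S A μ α :=
  Quot.mk _ p

/-- The algebra structure on `A(μ)/Δ_{μ,α}` (extensionally correct when `μ` is a
congruence and `Δ_{μ,α}` is a congruence of `A(μ)`). -/
noncomputable def DAlg (S : Signature) (A : Type) [SAlg S A] (μ α : Set (A × A))
    (h : IsSubuniverse S μ) : SAlg S (DCar S A μ α) :=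
  letI := subAlg μ h
  ⟨fun o x => DCar.mk S A μ α
    (SAlg.interp o fun i => Classical.choose (Quot.exists_rep (x i)))⟩

/-- The canonical similarity bridge `T_{D(A)}` from `A` to `D(A)`. -/
def TDBridge (S : Signature) (A : Type) [SAlg S A] (μ α : Set (A × A)) :
    Set (A × A × DCar S A μ α × DCar S A μ α) :=
  {x | ∃ (a b e : A) (_ : (a, b) ∈ μ) (h1 : (a, e) ∈ μ) (h2 : (b, e) ∈ μ),
    x = (a, b, DCar.mk S A μ α ⟨(a, e), h1⟩, DCar.mk S A μ α ⟨(b, e), h2⟩)}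

/-- Similarity of (subdirectly irreducible) algebras: `D(A) ≅ D(B)`, where `D(X)` is
`X(μ)/Δ_{μ,(0:μ)}` if the monolith `μ` is abelian, and `X` itself otherwise. -/
def SimilarI (S : Signature) {A B : Type} (iA : SAlg S A) (iB : SAlg S B) : Prop :=
  letI := iA
  letI := iB
  ∃ (μA : Set (A × A)) (μB : Set (B × B)) (hA : IsMonolith S μA) (hB : IsMonolith S μB),
    ((Centralizes S μA μA (diag A) ∧ Centralizes S μB μB (diag B)) →
      IsoAlgI (DAlg S A μA (centralizer S (diag A) μA) hA.1.1)
        (DAlg S B μB (centralizer S (diag B) μB) hB.1.1)) ∧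
    ((Centralizes S μA μA (diag A) ∧ ¬ Centralizes S μB μB (diag B)) →
      IsoAlgI (DAlg S A μA (centralizer S (diag A) μA) hA.1.1) iB) ∧
    ((¬ Centralizes S μA μA (diag A) ∧ Centralizes S μB μB (diag B)) →
      IsoAlgI iA (DAlg S B μB (centralizer S (diag B) μB) hB.1.1)) ∧
    ((¬ Centralizes S μA μA (diag A) ∧ ¬ Centralizes S μB μB (diag B)) →
      IsoAlgI iA iB)

end Zhuk

namespace Zhuk

section Bridges

variable {S : Signature} {A B C : Type} [SAlg S A] [SAlg S B] [SAlg S C]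

lemma IsSubuniverse.pr12 {T : Set (A × A × B × B)} (hT : IsSubuniverse S T) :
    IsSubuniverse S (pr12 T) := by
  intro o x hx
  choose b₁ b₂ h using hx
  exact ⟨_, _, hT o (fun i => ((x i).1, (x i).2, b₁ i, b₂ i)) h⟩

lemma IsSubuniverse.bConv {T : Set (A × A × B × B)} (hT : IsSubuniverse S T) :
    IsSubuniverse S (bConv T) := by
  intro o x hx
  exact hT o (fun i => ((x i).2.2.1, (x i).2.2.2, (x i).1, (x i).2.1)) hx

lemma IsSubuniverse.bComp {T : Set (A × A × B × B)} {T' : Set (B × B × C × C)}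
    (hT : IsSubuniverse S T) (hT' : IsSubuniverse S T') : IsSubuniverse S (bComp T T') := by
  intro o x hx
  choose b₁ b₂ h h' using hx
  exact ⟨_, _, hT o (fun i => ((x i).1, (x i).2.1, b₁ i, b₂ i)) h,
    hT' o (fun i => (b₁ i, b₂ i, (x i).2.2.1, (x i).2.2.2)) h'⟩

lemma IsBridge.bConv {ρ : Set (A × A)} {σ : Set (B × B)} {T : Set (A × A × B × B)}
    (hT : IsBridge S ρ σ T) : IsBridge S σ ρ (bConv T) := by
  obtain ⟨h0, hl, hr, h1, h2, h3⟩ := hT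
  exact ⟨h0.bConv, fun _ _ _ _ _ _ h => hr _ _ _ _ _ _ h, fun _ _ _ _ _ _ h => hl _ _ _ _ _ _ h,
    h2, h1, fun _ _ _ _ h => (h3 _ _ _ _ h).symm⟩

lemma IsBridgeLR.bConv {ρ L : Set (A × A)} {σ R : Set (B × B)} {T : Set (A × A × B × B)}
    (hT : IsBridgeLR S ρ σ L R T) : IsBridgeLR S σ ρ R L (bConv T) :=
  ⟨hT.1.bConv, hT.2.2, hT.2.1⟩

lemma IsBridgeLR.bComp {ρ L : Set (A × A)} {σ M : Set (B × B)} {τ R : Set (C × C)}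
    {T : Set (A × A × B × B)} {T' : Set (B × B × C × C)}
    (hT : IsBridgeLR S ρ σ L M T) (hT' : IsBridgeLR S σ τ M R T') :
    IsBridgeLR S ρ τ L R (bComp T T') := by
  obtain ⟨⟨h0, hl, hr, h1, h2, h3⟩, hL, hM⟩ := hT
  obtain ⟨⟨h0', hl', hr', h1', h2', h3'⟩, hM', hR⟩ := hT'
  have hpL : pr12 (Zhuk.bComp T T') = L := by
    subst hL
    ext ⟨a₁, a₂⟩
    constructor
    · rintro ⟨_, _, b₁, b₂, h, -⟩
      exact ⟨b₁, b₂, h⟩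
    · rintro ⟨b₁, b₂, h⟩
      obtain ⟨c₁, c₂, h'⟩ : (b₁, b₂) ∈ pr12 T' := by rw [hM', ← hM]; exact ⟨a₁, a₂, h⟩
      exact ⟨c₁, c₂, b₁, b₂, h, h'⟩
  have hpR : pr34 (Zhuk.bComp T T') = R := by
    subst hR
    ext ⟨c₁, c₂⟩
    constructor
    · rintro ⟨_, _, b₁, b₂, -, h⟩
      exact ⟨b₁, b₂, h⟩
    · rintro ⟨b₁, b₂, h⟩
      obtain ⟨a₁, a₂, h'⟩ : (b₁, b₂) ∈ pr34 T := by rw [hM, ← hM']; exact ⟨c₁, c₂, h⟩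
      exact ⟨a₁, a₂, b₁, b₂, h', h⟩
  refine ⟨⟨h0.bComp h0', ?_, ?_, ?_, ?_, ?_⟩, hpL, hpR⟩
  · rintro a₁ a₂ c₁ c₂ a₁' a₂' ⟨b₁, b₂, h, h'⟩ e₁ e₂
    exact ⟨b₁, b₂, hl _ _ _ _ _ _ h e₁ e₂, h'⟩
  · rintro a₁ a₂ c₁ c₂ c₁' c₂' ⟨b₁, b₂, h, h'⟩ e₁ e₂
    exact ⟨b₁, b₂, h, hr' _ _ _ _ _ _ h' e₁ e₂⟩
  · rw [hpL, ← hL]; exact h1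
  · rw [hpR, ← hR]; exact h2'
  · rintro a₁ a₂ c₁ c₂ ⟨b₁, b₂, h, h'⟩
    exact (h3 _ _ _ _ h).trans (h3' _ _ _ _ h')

lemma ReflBridge.bConv {T : Set (A × A × A × A)} (hT : ReflBridge T) : ReflBridge (bConv T) :=
  hT

lemma ReflBridge.bComp {T T' : Set (A × A × A × A)} (hT : ReflBridge T) (hT' : ReflBridge T') :
    ReflBridge (bComp T T') :=
  fun a => ⟨a, a, hT a, hT' a⟩

lemma ReflBridge.btr_subset_bComp_left {T T' : Set (A × A × A × A)} (hT' : ReflBridge T') :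
    btr T ⊆ btr (Zhuk.bComp T T') :=
  fun p hp => ⟨p.2, p.2, hp, hT' p.2⟩

lemma ReflBridge.btr_subset_bComp_right {T T' : Set (A × A × A × A)} (hT : ReflBridge T) :
    btr T' ⊆ btr (Zhuk.bComp T T') :=
  fun p hp => ⟨p.1, p.1, hT p.1, hp⟩

/-- The maximal member of `ref.tr(ρ,L)` is the greatest one. -/
lemma IsOptOf.subset {ρ L γ δ : Set (A × A)} (hγ : IsOptOf S ρ L γ) (hδ : δ ∈ refTr S ρ L) :
    δ ⊆ γ := by
  obtain ⟨⟨T, hT, hr, rfl⟩, hmax⟩ := hγ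
  obtain ⟨T', hT', hr', rfl⟩ := hδ
  rw [← hmax _ ⟨_, hT.bComp hT', hr.bComp hr', rfl⟩ hr'.btr_subset_bComp_left]
  exact hr.btr_subset_bComp_right

lemma IsOptOf.subset_of_reflBridge {ρ L σ R γ γ' : Set (A × A)} {T : Set (A × A × A × A)}
    (hγ : IsOptOf S ρ L γ) (hγ' : IsOptOf S σ R γ') (hT : IsBridgeLR S ρ σ L R T)
    (hr : ReflBridge T) : γ ⊆ γ' := by
  obtain ⟨⟨U, hU, hUr, rfl⟩, -⟩ := hγ
  refine subset_trans ?_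
    (hγ'.subset ⟨_, hT.bConv.bComp (hU.bComp hT), hr.bConv.bComp (hUr.bComp hr), rfl⟩)
  exact hr.btr_subset_bComp_left.trans hr.bConv.btr_subset_bComp_right

/-- The unique cover of an irreducible congruence lies below every saturated subuniverse
properly containing the congruence. -/
lemma subset_of_cov_eq_singleton [Finite A] {ρ ρstar L : Set (A × A)} (h : Cov S ρ = {ρstar})
    (hL : IsSubuniverse S L) (hs : Saturated ρ L) (hlt : ρ ⊂ L) : ρstar ⊆ L := by
  obtain ⟨M, hML, hM⟩ := exists_minimal_le_of_wellFoundedLT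
    (fun L' : Set (A × A) => IsSubuniverse S L' ∧ Saturated ρ L' ∧ ρ ⊂ L') L ⟨hL, hs, hlt⟩
  have hcov : M ∈ Cov S ρ := ⟨hM.prop.1, hM.prop.2.1, hM.prop.2.2,
    fun L' h₁ h₂ h₃ hle => hle.antisymm (hM.le_of_le ⟨h₁, h₂, h₃⟩ hle)⟩
  rw [h, Set.mem_singleton_iff] at hcov
  exact hcov ▸ hML

lemma saturated_iff {ρ R : Set (A × A)} (hρ : Equivalence fun a b => (a, b) ∈ ρ) :
    Saturated ρ R ↔ ∀ a b a' b', (a, b) ∈ R → (a, a') ∈ ρ → (b, b') ∈ ρ → (a', b') ∈ R := by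
  constructor
  · intro h a b a' b' hab ha hb
    rw [← h]
    exact ⟨a, hρ.symm ha, b, hab, hb⟩
  · intro h
    ext ⟨a, b⟩
    constructor
    · rintro ⟨c, hc, d, hd, he⟩
      exact h _ _ _ _ hd (hρ.symm hc) he
    · intro hab
      exact ⟨a, hρ.refl a, b, hab, hρ.refl b⟩

/-- Restricting the left anchor of a bridge. -/
lemma IsBridge.restrictLeft {ρ L σ : Set (A × A)} {T : Set (A × A × A × A)}
    (hT : IsBridge S ρ σ T) (hr : ReflBridge T) (hρ : IsCongruence S ρ)
    (hL : IsSubuniverse S L) (hs : Saturated ρ L) (hlt : ρ ⊂ L) (hle : L ⊆ Zhuk.pr12 T) :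
    ∃ T' ⊆ T, IsBridge S ρ σ T' ∧ ReflBridge T' ∧ Zhuk.pr12 T' = L := by
  obtain ⟨h0, hl, hr', h1, h2, h3⟩ := hT
  have hp : Zhuk.pr12 {p : A × A × A × A | p ∈ T ∧ (p.1, p.2.1) ∈ L} = L := by
    ext ⟨a₁, a₂⟩
    constructor
    · rintro ⟨_, _, -, h⟩
      exact h
    · intro h
      obtain ⟨b₁, b₂, hb⟩ := hle h
      exact ⟨b₁, b₂, hb, h⟩
  have hrefl : ∀ a, (a, a) ∈ L := fun a => hlt.1 (hρ.2.refl a)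
  refine ⟨{p | p ∈ T ∧ (p.1, p.2.1) ∈ L}, fun _ h => h.1, ⟨?_, ?_, ?_, hlt.trans_eq hp.symm, ?_, ?_⟩, ?_, hp⟩
  · intro o x hx
    exact ⟨h0 o x fun i => (hx i).1, hL o (fun i => ((x i).1, (x i).2.1)) fun i => (hx i).2⟩
  · rintro a₁ a₂ b₁ b₂ a₁' a₂' ⟨h, h'⟩ e₁ e₂
    exact ⟨hl _ _ _ _ _ _ h e₁ e₂, (saturated_iff hρ.2).1 hs _ _ _ _ h' e₁ e₂⟩
  · rintro a₁ a₂ b₁ b₂ b₁' b₂' ⟨h, h'⟩ e₁ e₂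
    exact ⟨hr' _ _ _ _ _ _ h e₁ e₂, h'⟩
  · refine Set.ssubset_iff_exists.2 ⟨?_, ?_⟩
    · rintro ⟨b₁, b₂⟩ hb
      obtain ⟨a₁, a₂, ha⟩ := h2.1 hb
      have hmem := (h3 _ _ _ _ ha).2 hb
      exact ⟨a₁, a₂, ha, hlt.1 hmem⟩
    · obtain ⟨-, ⟨a₁, a₂⟩, ha, hna⟩ := Set.ssubset_iff_exists.1 hlt
      obtain ⟨b₁, b₂, hb⟩ := hle ha
      exact ⟨(b₁, b₂), ⟨a₁, a₂, hb, ha⟩, fun hmem => hna ((h3 _ _ _ _ hb).2 hmem)⟩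
  · rintro a₁ a₂ b₁ b₂ ⟨h, -⟩
    exact h3 _ _ _ _ h
  · exact fun a => ⟨hr a, hrefl a⟩

lemma IsBridge.saturated_pr12 {ρ : Set (A × A)} {σ : Set (B × B)} {T : Set (A × A × B × B)}
    (hT : IsBridge S ρ σ T) (hρ : IsCongruence S ρ) : Saturated ρ (Zhuk.pr12 T) := by
  rw [saturated_iff hρ.2]
  rintro a b a' b' ⟨c, d, h⟩ ha hb
  exact ⟨c, d, hT.2.1 _ _ _ _ _ _ h ha hb⟩

/-- A reflexive bridge between irreducible congruences restricts to one anchored at their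
unique covers. -/
lemma IsBridge.exists_isBridgeLR_cov [Finite A] {ρ σ ρstar σstar : Set (A × A)}
    {T : Set (A × A × A × A)} (hT : IsBridge S ρ σ T) (hr : ReflBridge T)
    (hρ : IsCongruence S ρ) (hσ : IsCongruence S σ)
    (hρirr : Cov S ρ = {ρstar}) (hσirr : Cov S σ = {σstar}) :
    ∃ T', IsBridgeLR S ρ σ ρstar σstar T' ∧ ReflBridge T' := by
  obtain ⟨hρu, hρs, hρlt, hρmin⟩ : ρstar ∈ Cov S ρ := hρirr ▸ rfl
  obtain ⟨hσu, hσs, hσlt, -⟩ : σstar ∈ Cov S σ := hσirr ▸ rfl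
  obtain ⟨U, -, hU, hUr, hUp⟩ := hT.restrictLeft hr hρ hρu hρs hρlt
    (subset_of_cov_eq_singleton hρirr hT.1.pr12 (hT.saturated_pr12 hρ) hT.2.2.2.1)
  obtain ⟨V, hVU, hV, hVr, hVp⟩ := hU.bConv.restrictLeft hUr.bConv hσ hσu hσs hσlt
    (subset_of_cov_eq_singleton hσirr hU.1.bConv.pr12 (hU.bConv.saturated_pr12 hσ)
      hU.2.2.2.2.1)
  have hle : Zhuk.pr12 (Zhuk.bConv V) ⊆ ρstar := by
    rw [← hUp]
    rintro _ ⟨b₁, b₂, h⟩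
    exact ⟨b₁, b₂, hVU h⟩
  exact ⟨Zhuk.bConv V, ⟨hV.bConv, hρmin _ hV.bConv.1.pr12 (hV.bConv.saturated_pr12 hρ)
    hV.bConv.2.2.2.1 hle, hVp⟩, hVr.bConv⟩

end Bridges

end Zhuk

/-- adjacent irreducible congruences have the same `Opt`. -/
theorem stmt_6 {S : Zhuk.Signature} {A : Type} [Zhuk.SAlg S A] [Finite A]
    (ρ σ ρstar σstar : Set (A × A))
    (hρ : Zhuk.ConStar S ρ) (hσ : Zhuk.ConStar S σ)
    (hρirr : Zhuk.Cov S ρ = {ρstar}) (hσirr : Zhuk.Cov S σ = {σstar})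
    (T : Set (A × A × A × A)) (hT : Zhuk.IsBridge S ρ σ T) (href : Zhuk.ReflBridge T) :
    ∀ γ γ' : Set (A × A), Zhuk.IsOptOf S ρ ρstar γ → Zhuk.IsOptOf S σ σstar γ' →
      γ = γ' := by
  obtain ⟨U, hU, hUr⟩ := hT.exists_isBridgeLR_cov href hρ.1 hσ.1 hρirr hσirr
  exact fun γ γ' hγ hγ' => (hγ.subset_of_reflBridge hγ' hU hUr).antisymm
    (hγ'.subset_of_reflBridge hγ hU.bConv hUr.bConv)
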